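/- Let α be a positive integer, let p be an α-compatible sequence of length n, let T = T_α(p), and let β = Σ_{i=1}^n p_i. Then the multiset of edge labels of T is M_T = {1 with multiplicity 2nα−β, 2 with multiplicity β, 3 with multiplicity nα, 3α+1 with multiplicity n}. -/

import Mathlib

open scoped Classical

/-- The multiset of sizes of the connected components of a finite graph. -/
noncomputable def componentSizes {V : Type} [Fintype V] (H : SimpleGraph V) : Multiset ℕ :=
  (Finset.univ : Finset H.ConnectedComponent).val.map fun c => Nat.card c.supp

/-- The `U_k`-polynomial of a graph, encoded as the multiset of partitions
`λ(E \ A)` over all edge subsets `A` with `|A| ≤ k`.  Two graphs have the same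
`U_k`-polynomial iff these multisets coincide. -/
noncomputable def UkPoly {V : Type} [Fintype V] (G : SimpleGraph V) (k : ℕ) :
    Multiset (Multiset ℕ) :=
  (G.edgeFinset.powerset.filter fun A => A.card ≤ k).val.map fun A =>
    componentSizes (G.deleteEdges ↑A)

/-- The `U`-polynomial of a graph, encoded as the multiset of partitions
`λ(E \ A)` over all edge subsets `A`. -/
noncomputable def UPoly {V : Type} [Fintype V] (G : SimpleGraph V) :
    Multiset (Multiset ℕ) :=
  G.edgeFinset.powerset.val.map fun A => componentSizes (G.deleteEdges ↑A)

/-- Vertex type for the tree `T(p,s)`: a central vertex, roots `v_1,…,v_n`, and for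
each `i` the extra vertices of `p i` copies of a 4-vertex path and `s i` copies of
a 4-vertex star (3 extra vertices each, the remaining leaf being identified with
the root `v_i`). -/
abbrev Vtx (n : ℕ) (p s : Fin n → ℕ) : Type :=
  Unit ⊕ Fin n ⊕ ((Σ i : Fin n, Fin (p i) × Fin 3) ⊕ (Σ i : Fin n, Fin (s i) × Fin 3))

/-- Edges of `T(p,s)`: the central vertex is joined to each root `v_i`; each copy of
a 4-vertex path hangs from `v_i` as `v_i — x₀ — x₁ — x₂`; each copy of a 4-vertex
star hangs from `v_i` as `v_i — y₀` with extra leaves `y₁, y₂` adjacent to `y₀`. -/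
inductive TRel (n : ℕ) (p s : Fin n → ℕ) : Vtx n p s → Vtx n p s → Prop where
  | core (i : Fin n) :
      TRel n p s (Sum.inl ()) (Sum.inr (Sum.inl i))
  | pathRoot (i : Fin n) (j : Fin (p i)) :
      TRel n p s (Sum.inr (Sum.inl i)) (Sum.inr (Sum.inr (Sum.inl ⟨i, j, 0⟩)))
  | pathEdge (i : Fin n) (j : Fin (p i)) (l : Fin 2) :
      TRel n p s (Sum.inr (Sum.inr (Sum.inl ⟨i, j, l.castSucc⟩)))
        (Sum.inr (Sum.inr (Sum.inl ⟨i, j, l.succ⟩)))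
  | starRoot (i : Fin n) (j : Fin (s i)) :
      TRel n p s (Sum.inr (Sum.inl i)) (Sum.inr (Sum.inr (Sum.inr ⟨i, j, 0⟩)))
  | starEdge (i : Fin n) (j : Fin (s i)) (l : Fin 2) :
      TRel n p s (Sum.inr (Sum.inr (Sum.inr ⟨i, j, 0⟩)))
        (Sum.inr (Sum.inr (Sum.inr ⟨i, j, l.succ⟩)))

/-- The tree `T(p,s)`. -/
def TpsGraph (n : ℕ) (p s : Fin n → ℕ) : SimpleGraph (Vtx n p s) :=
  SimpleGraph.fromRel (TRel n p s)

/-- The PTE-tree `T_α(p) = T(p, α - p)`. -/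
def Ttree (α : ℕ) {n : ℕ} (p : Fin n → ℕ) : SimpleGraph (Vtx n p (fun i => α - p i)) :=
  TpsGraph n p (fun i => α - p i)

/-- `p` is an `α`-compatible sequence: it has length `n ≥ 2` and all entries `≤ α`. -/
def AlphaCompatible (α : ℕ) {n : ℕ} (p : Fin n → ℕ) : Prop :=
  2 ≤ n ∧ ∀ i, p i ≤ α

/-- The label `θ_e` of an edge of a tree: the smaller of the two component sizes
obtained after removing the edge. -/
noncomputable def edgeLabel {V : Type} [Fintype V] (G : SimpleGraph V) (e : Sym2 V) : ℕ :=
  sInf {m | m ∈ componentSizes (G.deleteEdges {e})}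

/-- The multiset of edge labels of the tree. -/
noncomputable def labelMultiset {V : Type} [Fintype V] (G : SimpleGraph V) : Multiset ℕ :=
  G.edgeFinset.val.map (edgeLabel G)

/-- In a graph whose vertex set splits into two connected pieces `D` and `Dᶜ` with no edge
between them, the component sizes are exactly `|D|` and `|Dᶜ|`. -/
lemma mem_componentSizes_of_bipartition {V : Type} [Fintype V] (H : SimpleGraph V)
    (D : Finset V) (v r : V) (hv : v ∈ D) (hr : r ∉ D)
    (hD : ∀ w ∈ D, H.Reachable w v) (hDc : ∀ w ∉ D, H.Reachable w r)
    (hcross : ∀ a b, H.Adj a b → (a ∈ D ↔ b ∈ D)) (m : ℕ) :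
    m ∈ componentSizes H ↔ m = D.card ∨ m = Fintype.card V - D.card := by
  have hreach : ∀ a b, H.Reachable a b → (a ∈ D ↔ b ∈ D) := by
    rintro a b ⟨w⟩
    induction w with
    | nil => rfl
    | cons h _ ih => exact (hcross _ _ h).trans ih
  have hsv : (H.connectedComponentMk v).supp = (D : Set V) := by
    ext w
    rw [SimpleGraph.ConnectedComponent.mem_supp_iff, SimpleGraph.ConnectedComponent.eq]
    exact ⟨fun h => (hreach _ _ h).2 hv, hD w⟩
  have hsr : (H.connectedComponentMk r).supp = ((Dᶜ : Finset V) : Set V) := by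
    ext w
    rw [SimpleGraph.ConnectedComponent.mem_supp_iff, SimpleGraph.ConnectedComponent.eq,
      Finset.mem_coe, Finset.mem_compl]
    exact ⟨fun h hw => hr ((hreach _ _ h).1 hw), hDc w⟩
  have hcv : Nat.card (H.connectedComponentMk v).supp = D.card := by
    rw [hsv, Nat.card_coe_set_eq, Set.ncard_coe_finset]
  have hcr : Nat.card (H.connectedComponentMk r).supp = Fintype.card V - D.card := by
    rw [hsr, Nat.card_coe_set_eq, Set.ncard_coe_finset, Finset.card_compl]
  rw [componentSizes, Multiset.mem_map]
  constructor
  · rintro ⟨c, -, rfl⟩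
    induction c using SimpleGraph.ConnectedComponent.ind with
    | h w =>
      by_cases hw : w ∈ D
      · left
        rw [SimpleGraph.ConnectedComponent.sound (hD w hw), hcv]
      · right
        rw [SimpleGraph.ConnectedComponent.sound (hDc w hw), hcr]
  · rintro (rfl | rfl)
    · exact ⟨_, Finset.mem_univ _, hcv⟩
    · exact ⟨_, Finset.mem_univ _, hcr⟩

/-- The graph joining every vertex other than the root `r` to its parent. -/
def parentGraph {V : Type} (r : V) (parent : V → V) : SimpleGraph V :=
  SimpleGraph.fromRel fun a b => b ≠ r ∧ a = parent b

section ParentGraph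

variable {V : Type} {r : V} {parent : V → V} {depth : V → ℕ}

lemma parentGraph_adj_parent (hdepth : ∀ u, u ≠ r → depth (parent u) < depth u)
    {u : V} (hu : u ≠ r) : (parentGraph r parent).Adj u (parent u) := by
  refine ⟨fun h => ?_, Or.inr ⟨hu, rfl⟩⟩
  have := hdepth u hu
  rw [← h] at this
  exact this.false

lemma parentEdge_injOn (hdepth : ∀ u, u ≠ r → depth (parent u) < depth u)
    {u v : V} (hu : u ≠ r) (hv : v ≠ r) (h : s(u, parent u) = s(v, parent v)) : u = v := by
  rcases Sym2.eq_iff.1 h with h | ⟨h₁, h₂⟩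
  · exact h.1
  · have hu' := hdepth u hu
    have hv' := hdepth v hv
    rw [h₂] at hu'
    rw [← h₁] at hv'
    omega

/-- Deleting the edge above `v` splits a parent graph into the descendants of `v`
and the remaining vertices. -/
lemma edgeLabel_parentGraph [Fintype V]
    (hdepth : ∀ u, u ≠ r → depth (parent u) < depth u) {v : V} (hvr : v ≠ r)
    (D : Finset V) (hv : v ∈ D) (hr : r ∉ D)
    (hD : ∀ u, u ≠ r → u ≠ v → (u ∈ D ↔ parent u ∈ D)) :
    edgeLabel (parentGraph r parent) s(v, parent v) =
      min D.card (Fintype.card V - D.card) := by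
  have hadj : ∀ u, u ≠ r → u ≠ v →
      ((parentGraph r parent).deleteEdges {s(v, parent v)}).Adj u (parent u) := by
    intro u hur huv
    rw [SimpleGraph.deleteEdges_adj]
    exact ⟨parentGraph_adj_parent hdepth hur,
      fun h => huv (parentEdge_injOn hdepth hur hvr h)⟩
  have hreach : ∀ k u, depth u = k →
      (u ∈ D → ((parentGraph r parent).deleteEdges {s(v, parent v)}).Reachable u v) ∧
      (u ∉ D → ((parentGraph r parent).deleteEdges {s(v, parent v)}).Reachable u r) := by
    intro k
    induction k using Nat.strong_induction_on with
    | _ k ih =>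
      rintro u rfl
      by_cases hur : u = r
      · subst hur
        exact ⟨fun h => absurd h hr, fun _ => .rfl⟩
      by_cases huv : u = v
      · subst huv
        exact ⟨fun _ => .rfl, fun h => absurd hv h⟩
      have ihu := ih _ (hdepth u hur) _ rfl
      exact ⟨fun h => (hadj u hur huv).reachable.trans (ihu.1 ((hD u hur huv).1 h)),
        fun h => (hadj u hur huv).reachable.trans
          (ihu.2 fun h' => h ((hD u hur huv).2 h'))⟩
  have hmem := mem_componentSizes_of_bipartition
    ((parentGraph r parent).deleteEdges {s(v, parent v)}) D v r hv hr
    (fun w => (hreach _ w rfl).1) (fun w => (hreach _ w rfl).2) (by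
      intro a b hab
      rw [SimpleGraph.deleteEdges_adj] at hab
      obtain ⟨⟨-, ⟨hb, rfl⟩ | ⟨ha, rfl⟩⟩, hne⟩ := hab
      · exact (hD b hb (by rintro rfl; exact hne Sym2.eq_swap)).symm
      · exact hD a ha (by rintro rfl; exact hne rfl))
  have hset : {m | m ∈ componentSizes ((parentGraph r parent).deleteEdges {s(v, parent v)})} =
      {D.card, Fintype.card V - D.card} := by
    ext m
    exact hmem m
  rw [edgeLabel, hset, csInf_pair]

/-- The edges of a parent graph are indexed by the vertices other than the root. -/
lemma labelMultiset_parentGraph [Fintype V] [DecidableEq V]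
    (hdepth : ∀ u, u ≠ r → depth (parent u) < depth u) :
    labelMultiset (parentGraph r parent) = (Finset.univ.erase r).val.map
      fun v => edgeLabel (parentGraph r parent) s(v, parent v) := by
  have hedge : (parentGraph r parent).edgeFinset =
      (Finset.univ.erase r).image fun v => s(v, parent v) := by
    ext e
    induction e using Sym2.ind with
    | _ a b =>
      simp only [SimpleGraph.mem_edgeFinset, SimpleGraph.mem_edgeSet, Finset.mem_image,
        Finset.mem_erase, Finset.mem_univ, and_true]
      constructor
      · rintro ⟨-, ⟨hb, rfl⟩ | ⟨ha, rfl⟩⟩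
        · exact ⟨b, hb, Sym2.eq_swap⟩
        · exact ⟨a, ha, rfl⟩
      · rintro ⟨u, hu, h⟩
        have hadj := parentGraph_adj_parent hdepth hu
        rwa [← SimpleGraph.mem_edgeSet, h, SimpleGraph.mem_edgeSet] at hadj
  rw [labelMultiset, hedge, Finset.image_val_of_injOn, Multiset.map_map]
  · rfl
  · intro u hu v hv h
    exact parentEdge_injOn hdepth (Finset.ne_of_mem_erase hu) (Finset.ne_of_mem_erase hv) h

end ParentGraph

section Tps

variable {n : ℕ} {p s : Fin n → ℕ}

/-- The parent of a vertex of `T(p,s)`, rooted at the central vertex. -/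
def tpsParent : Vtx n p s → Vtx n p s
  | Sum.inl _ => Sum.inl ()
  | Sum.inr (Sum.inl _) => Sum.inl ()
  | Sum.inr (Sum.inr (Sum.inl ⟨i, _, 0⟩)) => Sum.inr (Sum.inl i)
  | Sum.inr (Sum.inr (Sum.inl ⟨i, j, 1⟩)) => Sum.inr (Sum.inr (Sum.inl ⟨i, j, 0⟩))
  | Sum.inr (Sum.inr (Sum.inl ⟨i, j, 2⟩)) => Sum.inr (Sum.inr (Sum.inl ⟨i, j, 1⟩))
  | Sum.inr (Sum.inr (Sum.inr ⟨i, _, 0⟩)) => Sum.inr (Sum.inl i)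
  | Sum.inr (Sum.inr (Sum.inr ⟨i, j, 1⟩)) => Sum.inr (Sum.inr (Sum.inr ⟨i, j, 0⟩))
  | Sum.inr (Sum.inr (Sum.inr ⟨i, j, 2⟩)) => Sum.inr (Sum.inr (Sum.inr ⟨i, j, 0⟩))

/-- A height function on `T(p,s)` that strictly decreases towards the central vertex. -/
def tpsDepth : Vtx n p s → ℕ
  | Sum.inl _ => 0
  | Sum.inr (Sum.inl _) => 1
  | Sum.inr (Sum.inr (Sum.inl x)) => 2 + x.2.2
  | Sum.inr (Sum.inr (Sum.inr x)) => 2 + x.2.2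

lemma tpsDepth_parent_lt (u : Vtx n p s) (hu : u ≠ Sum.inl ()) :
    tpsDepth (tpsParent u) < tpsDepth u := by
  rcases u with _ | i | ⟨i, j, l⟩ | ⟨i, j, l⟩
  · exact absurd rfl hu
  · simp [tpsParent, tpsDepth]
  · fin_cases l <;> simp [tpsParent, tpsDepth]
  · fin_cases l <;> simp [tpsParent, tpsDepth]

lemma tRel_iff (a b : Vtx n p s) :
    TRel n p s a b ↔ b ≠ Sum.inl () ∧ a = tpsParent b := by
  constructor
  · rintro (i | ⟨i, j⟩ | ⟨i, j, l⟩ | ⟨i, j⟩ | ⟨i, j, l⟩)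
    · simp [tpsParent]
    · simp [tpsParent]
    · fin_cases l <;> simp [tpsParent]
    · simp [tpsParent]
    · fin_cases l <;> simp [tpsParent]
  · rintro ⟨hb, rfl⟩
    rcases b with _ | i | ⟨i, j, l⟩ | ⟨i, j, l⟩
    · exact absurd rfl hb
    · exact .core i
    · fin_cases l
      · exact .pathRoot i j
      · exact .pathEdge i j 0
      · exact .pathEdge i j 1
    · fin_cases l
      · exact .starRoot i j
      · exact .starEdge i j 0
      · exact .starEdge i j 1

lemma tpsGraph_eq_parentGraph :
    TpsGraph n p s = parentGraph (Sum.inl ()) tpsParent := by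
  have h : TRel n p s = fun a b => b ≠ Sum.inl () ∧ a = tpsParent b := by
    ext a b
    exact tRel_iff a b
  rw [TpsGraph, parentGraph, h]

lemma card_vtx : Fintype.card (Vtx n p s) = 1 + (n + (∑ i, p i * 3 + ∑ i, s i * 3)) := by
  simp

lemma edgeLabel_core (i : Fin n) :
    edgeLabel (parentGraph (V := Vtx n p s) (Sum.inl ()) tpsParent)
        s(Sum.inr (Sum.inl i), tpsParent (Sum.inr (Sum.inl i))) =
      min (1 + 3 * (p i + s i)) (Fintype.card (Vtx n p s) - (1 + 3 * (p i + s i))) := by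
  let f : Unit ⊕ (Fin (p i) × Fin 3 ⊕ Fin (s i) × Fin 3) → Vtx n p s :=
    Sum.elim (fun _ => Sum.inr (Sum.inl i))
      (Sum.elim (fun x => Sum.inr (Sum.inr (Sum.inl ⟨i, x⟩)))
        (fun x => Sum.inr (Sum.inr (Sum.inr ⟨i, x⟩))))
  have hf : Function.Injective f := by
    rintro (_ | x | x) (_ | y | y) h <;> simp_all [f]
  have hcard : (Finset.univ.image f).card = 1 + 3 * (p i + s i) := by
    rw [Finset.card_image_of_injective _ hf]
    simp
    ring
  rw [← hcard]
  refine edgeLabel_parentGraph tpsDepth_parent_lt (by simp) _ ?_ ?_ ?_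
  · exact Finset.mem_image.2 ⟨Sum.inl (), Finset.mem_univ _, rfl⟩
  · simp [f]
  · rintro (_ | i' | ⟨i', j', l'⟩ | ⟨i', j', l'⟩) h₁ h₂
    · exact absurd rfl h₁
    · simp [f, tpsParent] at h₂ ⊢
      exact fun h => h₂ h.symm
    · by_cases hi : i = i'
      · subst hi
        fin_cases l' <;> simp [f, tpsParent]
      · fin_cases l' <;> simp [f, tpsParent, hi]
    · by_cases hi : i = i'
      · subst hi
        fin_cases l' <;> simp [f, tpsParent]
      · fin_cases l' <;> simp [f, tpsParent, hi]

lemma edgeLabel_path (i : Fin n) (j : Fin (p i)) (l : Fin 3) :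
    edgeLabel (parentGraph (V := Vtx n p s) (Sum.inl ()) tpsParent)
        s(Sum.inr (Sum.inr (Sum.inl ⟨i, j, l⟩)),
          tpsParent (Sum.inr (Sum.inr (Sum.inl ⟨i, j, l⟩)))) =
      min (3 - l : ℕ) (Fintype.card (Vtx n p s) - (3 - l : ℕ)) := by
  let f : Fin 3 → Vtx n p s := fun m => Sum.inr (Sum.inr (Sum.inl ⟨i, j, m⟩))
  have hf : Function.Injective f := by
    intro x y h
    simpa [f] using h
  have hcard : ((Finset.Ici l).image f).card = (3 - l : ℕ) := by
    rw [Finset.card_image_of_injective _ hf, Fin.card_Ici]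
  rw [← hcard]
  refine edgeLabel_parentGraph tpsDepth_parent_lt (by simp) _ ?_ ?_ ?_
  · exact Finset.mem_image.2 ⟨l, Finset.mem_Ici.2 le_rfl, rfl⟩
  · simp [f]
  · rintro (_ | i' | ⟨i', j', l'⟩ | ⟨i', j', l'⟩) h₁ h₂
    · exact absurd rfl h₁
    · simp [f, tpsParent]
    · by_cases hi : i = i'
      · subst hi
        by_cases hj : j = j'
        · subst hj
          fin_cases l <;> fin_cases l' <;> simp_all [f, tpsParent]
        · fin_cases l' <;> simp [f, tpsParent, hj]
      · fin_cases l' <;> simp [f, tpsParent, hi]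
    · fin_cases l' <;> simp [f, tpsParent]

lemma edgeLabel_star (i : Fin n) (j : Fin (s i)) (l : Fin 3) :
    edgeLabel (parentGraph (V := Vtx n p s) (Sum.inl ()) tpsParent)
        s(Sum.inr (Sum.inr (Sum.inr ⟨i, j, l⟩)),
          tpsParent (Sum.inr (Sum.inr (Sum.inr ⟨i, j, l⟩)))) =
      min (if l = 0 then 3 else 1) (Fintype.card (Vtx n p s) - if l = 0 then 3 else 1) := by
  let f : Fin 3 → Vtx n p s := fun m => Sum.inr (Sum.inr (Sum.inr ⟨i, j, m⟩))
  have hf : Function.Injective f := by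
    intro x y h
    simpa [f] using h
  have hcard : ((if l = 0 then Finset.univ else {l} : Finset (Fin 3)).image f).card =
      if l = 0 then 3 else 1 := by
    rw [Finset.card_image_of_injective _ hf]
    split_ifs <;> simp
  rw [← hcard]
  refine edgeLabel_parentGraph tpsDepth_parent_lt (by simp) _ ?_ ?_ ?_
  · refine Finset.mem_image.2 ⟨l, ?_, rfl⟩
    split_ifs <;> simp
  · simp [f]
  · rintro (_ | i' | ⟨i', j', l'⟩ | ⟨i', j', l'⟩) h₁ h₂
    · exact absurd rfl h₁
    · simp [f, tpsParent]
    · fin_cases l' <;> simp [f, tpsParent]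
    · by_cases hi : i = i'
      · subst hi
        by_cases hj : j = j'
        · subst hj
          fin_cases l <;> fin_cases l' <;> simp_all [f, tpsParent]
        · fin_cases l' <;> simp [f, tpsParent, hj]
      · fin_cases l' <;> simp [f, tpsParent, hi]

lemma map_erase_center (g : Vtx n p s → ℕ) :
    (Finset.univ.erase (Sum.inl ())).val.map g =
      ∑ i, {g (Sum.inr (Sum.inl i))} +
      (∑ i, ∑ j, ∑ l, {g (Sum.inr (Sum.inr (Sum.inl ⟨i, j, l⟩)))} +
        ∑ i, ∑ j, ∑ l, {g (Sum.inr (Sum.inr (Sum.inr ⟨i, j, l⟩)))}) := by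
  have h : (Finset.univ.erase (Sum.inl ()) : Finset (Vtx n p s)) =
      Finset.univ.map Function.Embedding.inr := by
    ext (_ | x) <;> simp
  rw [h, Finset.map_val, Multiset.map_map,
    ← Multiset.sum_map_singleton (Multiset.map _ _), Multiset.map_map]
  change ∑ x, {g (Sum.inr x)} = _
  simp [Fintype.sum_sigma, Fintype.sum_prod_type]

end Tps

/-- For `T = T_α(p)` with `β = Σ_i p_i`, the multiset of edge labels of `T` is
`{1^(2nα−β), 2^β, 3^(nα), (3α+1)^n}`. -/
theorem labelMultiset_Ttree (α n : ℕ) (hα : 0 < α)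
    (p : Fin n → ℕ) (hp : AlphaCompatible α p) :
    labelMultiset (Ttree α p) =
      Multiset.replicate (2 * n * α - ∑ i, p i) 1 +
      Multiset.replicate (∑ i, p i) 2 +
      Multiset.replicate (n * α) 3 +
      Multiset.replicate n (3 * α + 1) := by
  obtain ⟨hn, hle⟩ := hp
  have hsum : ∑ i, p i + ∑ i, (α - p i) = n * α := by
    rw [← Finset.sum_add_distrib, Finset.sum_congr rfl fun i _ => Nat.add_sub_cancel' (hle i)]
    simp
  have hcard : Fintype.card (Vtx n p fun i => α - p i) = 1 + (n + 3 * (n * α)) := by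
    rw [card_vtx, ← Finset.sum_mul, ← Finset.sum_mul, ← hsum]
    ring
  have hnα : 2 * α ≤ n * α := Nat.mul_le_mul_right α hn
  rw [Ttree, tpsGraph_eq_parentGraph, labelMultiset_parentGraph tpsDepth_parent_lt,
    map_erase_center]
  have hcore : ∀ i : Fin n, min (1 + 3 * (p i + (α - p i)))
      (1 + (n + 3 * (n * α)) - (1 + 3 * (p i + (α - p i)))) = 3 * α + 1 := by
    intro i
    have := hle i
    omega
  have hsmall : ∀ k ≤ 3, min k (1 + (n + 3 * (n * α)) - k) = k := by
    intro k hk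
    omega
  have hpath : ∀ l : Fin 3, min (3 - l : ℕ) (1 + (n + 3 * (n * α)) - (3 - l : ℕ)) = 3 - l :=
    fun l => hsmall _ (Nat.sub_le _ _)
  have hstar : ∀ l : Fin 3, min (if l = 0 then 3 else 1)
      (1 + (n + 3 * (n * α)) - if l = 0 then 3 else 1) = if l = 0 then 3 else 1 :=
    fun l => hsmall _ (by split_ifs <;> omega)
  simp only [edgeLabel_core, edgeLabel_path, edgeLabel_star, hcard, hcore, hpath, hstar,
    Fin.sum_univ_three, Finset.sum_const, Finset.card_univ, Fintype.card_fin,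
    Finset.sum_nsmul_assoc]
  have hmult : 2 * n * α - ∑ i, p i = ∑ i, p i + 2 * ∑ i, (α - p i) := by
    rw [mul_assoc]
    omega
  rw [hmult, ← hsum]
  simp only [← Multiset.nsmul_singleton, Fin.val_zero, Fin.val_one, Fin.val_two, Nat.sub_zero,
    Nat.reduceSub, if_true, Fin.reduceEq, if_false]
  module
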